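/- Let B be a directed basic finite-dimensional k-algebra with precedence partial order ⪯ on 𝒫, and let ≤L be any linear order on 𝒫 such that i <L j whenever i ≺ j. Then for each i ∈ 𝒫 the trace T_i^L := Σ { Im f : f ∈ Hom_B(P_j, P_i), ¬(j ≤L i) } equals rad(P_i), so the standard B-modules relative to (𝒫, ≤L) are the simple modules S_i; moreover (𝒫, ≤L, {S_i}_{i∈𝒫}) is a strict homological system for B and End_B(S_i) ≅ k for all i. Consequently B is quasi-hereditary with simple standard modules. -/

import Mathlib

/-!
# Statement 6

For a directed basic finite-dimensional algebra `B` and any linearization `≤` of its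
precedence order `≺`, the standard modules relative to `(ι, ≤)` are the simple modules,
`(ι, ≤, {S i})` is a strict homological system, and `End_B(S i) ≅ k`; hence `B` is
quasi-hereditary with simple standard modules.
-/

open CategoryTheory

noncomputable section

variable (k : Type) [Field k] [IsAlgClosed k]
variable (B : Type) [Ring B] [Algebra k B] [FiniteDimensional k B]

/-- `Ext^n_B(X, Y)`, as a `k`-module. -/
noncomputable abbrev extGrp (n : ℕ) (X Y : ModuleCat B) : ModuleCat k :=
  ((Ext k (ModuleCat B) n).obj (Opposite.op X)).obj Y

/-- Nonvanishing of `Ext^n_B(X, Y)`. -/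
def extNZ (n : ℕ) (X Y : ModuleCat B) : Prop := Nontrivial (extGrp k B n X Y)

/-- A module is indecomposable. -/
def Indec (M : ModuleCat B) : Prop :=
  Nontrivial M ∧ ∀ N₁ N₂ : Submodule B M, IsCompl N₁ N₂ → N₁ = ⊥ ∨ N₂ = ⊥

variable (ι : Type) [Fintype ι] [LinearOrder ι]

/-- `M` is zero or admits a finite filtration with factors among `{Δ i | ok i}`. -/
def HasFiltBy (Δ : ι → ModuleCat B) (ok : ι → Prop)
    (M : Type) [AddCommGroup M] [Module B M] : Prop :=
  Subsingleton M ∨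
    ∃ (t : ℕ) (F : Fin (t + 1) → Submodule B M), Monotone F ∧ F 0 = ⊥ ∧ F (Fin.last t) = ⊤ ∧
      ∀ r : Fin t, ∃ i : ι, ok i ∧
        Nonempty ((↥(F r.succ) ⧸ Submodule.comap (F r.succ).subtype (F r.castSucc)) ≃ₗ[B] Δ i)

/-- Complete irredundant family of representatives of the indecomposable projectives. -/
def IsCompleteProjFam (P : ι → ModuleCat B) : Prop :=
  (∀ i, Module.Finite B (P i) ∧ Indec B (P i) ∧ Projective (P i)) ∧
  (∀ i j, i ≠ j → IsEmpty (P i ≅ P j)) ∧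
  (∀ X : ModuleCat B, Module.Finite B X → Indec B X → Projective X → ∃ i, Nonempty (X ≅ P i))

variable (e : ι → B)

/-- The indecomposable projective `P i = B⬝(e i)`, as a submodule of `B`. -/
def Pmod (i : ι) : Submodule B B := LinearMap.range (LinearMap.toSpanSingleton B B (e i))

/-- The radical of a module: the intersection of its maximal submodules. -/
def radOf (M : Type) [AddCommGroup M] [Module B M] : Submodule B M := sInf {N | IsCoatom N}

/-- The simple module `S i = P i / rad (P i)`. -/
abbrev Smod (i : ι) := (↥(Pmod B ι e i)) ⧸ (radOf B ↥(Pmod B ι e i))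

/-- The simple module `S i`, as an object of `ModuleCat B`. -/
noncomputable abbrev SmodCat (i : ι) : ModuleCat B := ModuleCat.of B (Smod B ι e i)

/-- The relation `i ≺₀ j` iff `Ext¹_B(S i, S j) ≠ 0`. -/
def prec0 (i j : ι) : Prop := extNZ k B 1 (SmodCat B ι e i) (SmodCat B ι e j)

/-- The strict precedence relation `≺`: the transitive closure of `≺₀`. -/
def prec (i j : ι) : Prop := Relation.TransGen (prec0 k B ι e) i j

/-- `e` is a complete family of primitive orthogonal idempotents of `B`. -/
structure IsCompletePrimitiveIdem : Prop where
  idem : ∀ i, IsIdempotentElem (e i)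
  orth : ∀ i j, i ≠ j → e i * e j = 0
  sum_eq_one : ∑ i, e i = 1
  ne_zero : ∀ i, e i ≠ 0
  primitive : ∀ (i : ι) (f g : B), IsIdempotentElem f → IsIdempotentElem g →
    f * g = 0 → g * f = 0 → e i = f + g → f = 0 ∨ g = 0

/-- The trace submodule `T^L i ⊆ P i` relative to the linear order: the sum of the
images of all homomorphisms `P j → P i` with `¬ (j ≤ i)`. -/
def traceSubL (i : ι) : Submodule B ↥(Pmod B ι e i) :=
  ⨆ (j : ι) (_ : ¬ (j ≤ i))
    (f : ↥(Pmod B ι e j) →ₗ[B] ↥(Pmod B ι e i)), LinearMap.range f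

set_option linter.unusedSectionVars false

section General
variable {R : Type} [Ring R]

def IndecL (R : Type) [Ring R] (M : Type*) [AddCommGroup M] [Module R M] : Prop :=
  ∀ N₁ N₂ : Submodule R M, IsCompl N₁ N₂ → N₁ = ⊥ ∨ N₂ = ⊥

variable {M N : Type} [AddCommGroup M] [Module R M] [AddCommGroup N] [Module R N]

theorem fitting_dichotomy [IsArtinian R M] [IsNoetherian R M] (h : IndecL R M)
    (f : M →ₗ[R] M) : IsNilpotent f ∨ Function.Bijective f := by
  have hev := f.eventually_isCompl_ker_pow_range_pow
  obtain ⟨n, hn⟩ := Filter.eventually_atTop.1 hev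
  have h1 := hn (n+1) (by omega)
  rcases h _ _ h1 with h2 | h2
  · right
    have hinj : Function.Injective (f ^ (n+1)) := LinearMap.ker_eq_bot.1 h2
    have : Function.Injective f := by
      rw [pow_succ] at hinj
      exact Function.Injective.of_comp (f := (f^n)) hinj
    exact IsArtinian.bijective_of_injective_endomorphism f this
  · left
    exact ⟨n+1, LinearMap.range_eq_bot.1 h2⟩

theorem surj_split {M : Type*} [AddCommGroup M] [Module R M] [Module.Projective R N] [Nontrivial N] (h : IndecL R M)
    (f : M →ₗ[R] N) (hf : Function.Surjective f) : Function.Bijective f := by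
  obtain ⟨s, hs⟩ := Module.projective_lifting_property f LinearMap.id hf
  have hc : IsCompl (LinearMap.ker f) (LinearMap.range s) := by
    constructor
    · rw [Submodule.disjoint_def]
      rintro x hx ⟨y, rfl⟩
      have : f (s y) = y := LinearMap.congr_fun hs y
      rw [LinearMap.mem_ker, this] at hx
      simp [hx]
    · rw [codisjoint_iff, Submodule.eq_top_iff']
      intro x
      have : f (s (f x)) = f x := LinearMap.congr_fun hs (f x)
      rw [show x = (x - s (f x)) + s (f x) by abel]
      exact Submodule.add_mem_sup (by simp [LinearMap.mem_ker, this]) ⟨_, rfl⟩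
  rcases h _ _ hc with h2 | h2
  · exact ⟨LinearMap.ker_eq_bot.1 h2, hf⟩
  · exfalso
    rw [LinearMap.range_eq_bot] at h2
    subst h2
    obtain ⟨y, hy⟩ := exists_ne (0 : N)
    exact hy (by have := LinearMap.congr_fun hs y; simpa using this.symm)

theorem coatom_unique [IsArtinian R M] [IsNoetherian R M] [Module.Projective R M]
    (h : IndecL R M) {K K' : Submodule R M} (hK : IsCoatom K) (hK' : IsCoatom K') : K = K' := by
  by_contra hne
  have hsup : K ⊔ K' = ⊤ := hK.sup_eq_top_of_ne hK' hne
  have hs : Function.Surjective (K'.mkQ ∘ₗ K.subtype) := by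
    rw [← LinearMap.range_eq_top, LinearMap.range_comp, Submodule.range_subtype]
    have h1 : Submodule.map K'.mkQ (K ⊔ K') = ⊤ := by
      rw [hsup, Submodule.map_top, Submodule.range_mkQ]
    have h2 : Submodule.map K'.mkQ K' = ⊥ := by
      exact Submodule.mkQ_map_self K'
    rwa [Submodule.map_sup, h2, sup_bot_eq] at h1
  obtain ⟨g, hg⟩ := Module.projective_lifting_property _ K'.mkQ hs
  let f : M →ₗ[R] M := K.subtype ∘ₗ g
  have hf : ∀ x, f x - x ∈ K' := by
    intro x
    rw [← Submodule.Quotient.eq]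
    exact LinearMap.congr_fun hg x
  rcases fitting_dichotomy h f with ⟨n, hn⟩ | hb
  · apply hK'.1
    rw [Submodule.eq_top_iff']
    intro x
    have : ∀ n, (f ^ n) x - x ∈ K' := by
      intro n
      induction n with
      | zero => simp
      | succ n ih =>
        rw [pow_succ', Module.End.mul_apply]
        have := K'.add_mem (hf ((f^n) x)) ih
        simpa using this
    have := this n
    rw [hn] at this
    simpa using this
  · apply hK.1
    rw [Submodule.eq_top_iff']
    intro x
    obtain ⟨y, rfl⟩ := hb.2 x
    exact (g y).2

theorem radOf_coatom [IsArtinian R M] [IsNoetherian R M] [Module.Projective R M] [Nontrivial M]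
    (h : IndecL R M) : IsCoatom (radOf R M) := by
  obtain ⟨K, hK, -⟩ := (eq_top_or_exists_le_coatom (⊥ : Submodule R M)).resolve_left bot_ne_top
  have : radOf R M = K := by
    apply le_antisymm
    · exact sInf_le hK
    · exact le_sInf fun K' hK' => (coatom_unique h hK hK').le
  rwa [this]

theorem le_radOf [IsArtinian R M] [IsNoetherian R M] [Module.Projective R M] [Nontrivial M]
    (h : IndecL R M) {K : Submodule R M} (hK : K ≠ ⊤) : K ≤ radOf R M := by
  obtain ⟨K', hK', hle⟩ := (eq_top_or_exists_le_coatom K).resolve_left hK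
  rwa [← coatom_unique h hK' (radOf_coatom h)]

theorem coatom_eq_radOf [IsArtinian R M] [IsNoetherian R M] [Module.Projective R M] [Nontrivial M]
    (h : IndecL R M) {K : Submodule R M} (hK : IsCoatom K) : K = radOf R M :=
  coatom_unique h hK (radOf_coatom h)

end General

section Homological

open CategoryTheory.Limits

/-- A choice function of presentations; used to build resolutions. -/
def covD {C : Type 1} [Category.{0} C] [Abelian C]
    (cov : ∀ M : C, ProjectivePresentation M) {X₀ X₁ : C} (f : X₁ ⟶ X₀) :
    Σ' (X₂ : C) (d : X₂ ⟶ X₁), d ≫ f = 0 :=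
  ⟨(cov (kernel f)).p, (cov (kernel f)).f ≫ kernel.ι f, by simp⟩

theorem covD_exact {C : Type 1} [Category.{0} C] [Abelian C]
    (cov : ∀ M : C, ProjectivePresentation M) {X₀ X₁ : C} (f : X₁ ⟶ X₀) :
    (ShortComplex.mk (covD cov f).2.1 f (covD cov f).2.2).Exact := by
  let α : ShortComplex.mk (covD cov f).2.1 f (covD cov f).2.2 ⟶
      ShortComplex.mk (kernel.ι f) f (by simp) :=
    { τ₁ := (cov (kernel f)).f
      τ₂ := 𝟙 _
      τ₃ := 𝟙 _
      comm₁₂ := by simp [covD]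
      comm₂₃ := by simp }
  have : Epi α.τ₁ := (cov (kernel f)).epi
  have : IsIso α.τ₂ := by dsimp [α]; infer_instance
  have : Mono α.τ₃ := by dsimp [α]; infer_instance
  rw [ShortComplex.exact_iff_of_epi_of_isIso_of_mono α]
  apply ShortComplex.exact_of_f_is_kernel
  apply kernelIsKernel

theorem exists_resolution {C : Type 1} [Category.{0} C] [Abelian C]
    (Supp : C → Prop) (hmono : ∀ {X Y : C} (f : X ⟶ Y), Mono f → Supp Y → Supp X)
    (hcov : ∀ M : C, ∃ p : ProjectivePresentation M, Supp M → Supp p.p)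
    (M Q : C) (π : Q ⟶ M) [Projective Q] [Epi π] (hk : Supp (kernel π)) :
    ∃ R : ProjectiveResolution M, ∀ n, Supp (R.complex.X (n + 1)) := by
  choose cov hcov using hcov
  let K : ChainComplex C ℕ := ChainComplex.mk' Q (covD cov π).1 (covD cov π).2.1 (covD cov)
  have hX (n : ℕ) : K.X (n + 2) ≅ (cov (kernel (K.d (n+1) n))).p :=
    ChainComplex.mk'XIso Q (covD cov π).1 (covD cov π).2.1 (covD cov) n
  have hd10 : K.d 1 0 = (covD cov π).2.1 := ChainComplex.mk'_d_1_0 ..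
  have hd (n : ℕ) : K.d (n + 2) (n + 1) =
      (ChainComplex.mk'XIso Q (covD cov π).1 (covD cov π).2.1 (covD cov) n).hom ≫
      (covD cov (K.d (n + 1) n)).2.1 :=
    ChainComplex.mk'_d Q (covD cov π).1 (covD cov π).2.1 (covD cov) n
  have hsupp : ∀ n, Supp (K.X (n + 1)) := by
    intro n
    induction n with
    | zero => exact hcov _ hk
    | succ n ih =>
      exact hmono (hX n).hom inferInstance (hcov _ (hmono (kernel.ι _) inferInstance ih))
  have hproj : ∀ n, Projective (K.X n) := by
    rintro (_ | _ | n)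
    · exact ‹Projective Q›
    · exact (cov (kernel π)).projective
    · exact Projective.of_iso (hX n).symm (cov _).projective
  have hex : ∀ n, K.ExactAt (n + 1) := by
    intro n
    rw [HomologicalComplex.exactAt_iff' _ (n + 1 + 1) (n + 1) n (by simp) (by simp)]
    let β : K.sc' (n+1+1) (n+1) n ≅ ShortComplex.mk (covD cov (K.d (n+1) n)).2.1 (K.d (n+1) n)
        (covD cov _).2.2 :=
      ShortComplex.isoMk (ChainComplex.mk'XIso Q (covD cov π).1 (covD cov π).2.1 (covD cov) n)
        (Iso.refl _) (Iso.refl _)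
        ((hd n).symm.trans (Category.comp_id _).symm)
        ((Category.id_comp _).trans (Category.comp_id _).symm)
    exact (ShortComplex.exact_iff_of_iso β).2 (covD_exact cov _)
  refine ⟨{ complex := K
            projective := hproj
            π := (ChainComplex.toSingle₀Equiv _ _).symm ⟨π, by
              rw [hd10]; exact (covD cov π).2.2⟩
            quasiIso := ⟨fun n => ?_⟩ }, hsupp⟩
  cases n
  · rw [ChainComplex.quasiIsoAt₀_iff, ShortComplex.quasiIso_iff_of_zeros']
    · refine (ShortComplex.exact_and_epi_g_iff_of_iso ?_).2
          ⟨covD_exact cov π, by dsimp; infer_instance⟩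
      refine ShortComplex.isoMk (Iso.refl _) (Iso.refl _) (Iso.refl _) ?_ ?_
      · refine (Category.id_comp _).trans (Eq.trans ?_ (Category.comp_id _).symm)
        exact hd10.symm
      · refine (Category.id_comp _).trans (Eq.trans ?_ (Category.comp_id _).symm)
        exact (ChainComplex.toSingle₀Equiv_symm_apply_f_zero (C := K) (X := M) π _).symm
    all_goals rfl
  · rw [quasiIsoAt_iff_exactAt']
    · apply hex
    · apply ChainComplex.exactAt_succ_single_obj

theorem ext_vanish (k : Type) [Field k] (B : Type) [Ring B] [Algebra k B]
    {M Y : ModuleCat B} (R : ProjectiveResolution M) (n : ℕ)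
    (h : ∀ f : R.complex.X n ⟶ Y, f = 0) : ¬ extNZ k B n M Y := by
  have : IsZero (((Ext k (ModuleCat B) n).obj (Opposite.op M)).obj Y) := by
    refine IsZero.of_iso ?_ (R.isoExt n Y)
    rw [← HomologicalComplex.exactAt_iff_isZero_homology, HomologicalComplex.exactAt_iff]
    refine ShortComplex.exact_of_isZero_X₂ _ ?_
    rw [IsZero.iff_id_eq_zero]
    ext (x : _ ⟶ _)
    obtain rfl : x = 0 := h x
    rfl
  unfold extNZ
  rw [not_nontrivial_iff_subsingleton]
  exact ModuleCat.subsingleton_of_isZero this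

theorem ext_one_factor (k : Type) [Field k] (B : Type) [Ring B] [Algebra k B]
    {M Y : ModuleCat B} (R : ProjectiveResolution M)
    (h : ¬ extNZ k B 1 M Y) (f : R.complex.X 1 ⟶ Y) (hf : R.complex.d 2 1 ≫ f = 0) :
    ∃ g : R.complex.X 0 ⟶ Y, f = R.complex.d 1 0 ≫ g := by
  have hz : IsZero ((R.complex.linearYonedaObj k Y).homology 1) := by
    refine IsZero.of_iso ?_ (R.isoExt 1 Y).symm
    unfold extNZ at h
    rw [not_nontrivial_iff_subsingleton] at h
    exact ModuleCat.isZero_of_subsingleton _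
  rw [← HomologicalComplex.exactAt_iff_isZero_homology,
    HomologicalComplex.exactAt_iff' _ 0 1 2 (by simp) (by simp),
    ShortComplex.moduleCat_exact_iff] at hz
  obtain ⟨g, hg⟩ := hz f hf
  exact ⟨g, hg.symm⟩

theorem ext_one_extend (k : Type) [Field k] (B : Type) [Ring B] [Algebra k B]
    {M Q Y : Type} [AddCommGroup M] [Module B M] [AddCommGroup Q] [Module B Q]
    [AddCommGroup Y] [Module B Y] [Module.Projective B Q]
    (h : ¬ extNZ k B 1 (ModuleCat.of B M) (ModuleCat.of B Y))
    (π : Q →ₗ[B] M) (hπ : Function.Surjective π) (g : LinearMap.ker π →ₗ[B] Y) :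
    ∃ g' : Q →ₗ[B] Y, ∀ x : LinearMap.ker π, g' x = g x := by
  let R := projectiveResolution (ModuleCat.of B M)
  have hp0 : Module.Projective B (R.complex.X 0) := by
    rw [IsProjective.iff_projective]
    exact R.projective 0
  let ρ : R.complex.X 0 →ₗ[B] M := (R.π.f 0).hom
  have hρ : Function.Surjective ρ :=
    (ModuleCat.epi_iff_surjective (R.π.f 0)).1 inferInstance
  obtain ⟨v, hv⟩ := Module.projective_lifting_property π ρ hπ
  obtain ⟨u, hu⟩ := Module.projective_lifting_property ρ π hρ
  have hv' : ∀ x, π (v x) = ρ x := LinearMap.congr_fun hv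
  have hu' : ∀ x, ρ (u x) = π x := LinearMap.congr_fun hu
  let d : R.complex.X 1 →ₗ[B] R.complex.X 0 := (R.complex.d 1 0).hom
  have hd : ∀ x, ρ (d x) = 0 := fun x => by
    have := R.complex_d_comp_π_f_zero
    exact LinearMap.congr_fun (congrArg ModuleCat.Hom.hom this) x
  have hex : ∀ y, ρ y = 0 → ∃ x, d x = y := by
    have := R.exact₀
    rw [ShortComplex.moduleCat_exact_iff] at this
    exact this
  have hdd : ∀ x, d ((R.complex.d 2 1).hom x) = 0 := fun x => by
    have := R.complex.d_comp_d 2 1 0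
    exact LinearMap.congr_fun (congrArg ModuleCat.Hom.hom this) x
  let w : R.complex.X 1 →ₗ[B] LinearMap.ker π :=
    LinearMap.codRestrict _ (v ∘ₗ d) (fun x => by
      rw [LinearMap.mem_ker, LinearMap.comp_apply, hv', hd])
  obtain ⟨h', hh'⟩ := ext_one_factor k B R h (ModuleCat.ofHom (g ∘ₗ w)) (by
    ext x
    change g (w _) = 0
    have : w ((R.complex.d 2 1).hom x) = 0 := by
      apply Subtype.ext
      change v (d _) = 0
      rw [hdd, map_zero]
    exact (congrArg g this).trans (map_zero g))
  have hh : ∀ x, g (w x) = h'.hom (d x) := fun x =>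
    LinearMap.congr_fun (congrArg ModuleCat.Hom.hom hh') x
  let t : Q →ₗ[B] LinearMap.ker π :=
    LinearMap.codRestrict _ (v ∘ₗ u - LinearMap.id) (fun x => by
      rw [LinearMap.mem_ker]; simp [hv', hu'])
  refine ⟨h'.hom ∘ₗ u - g ∘ₗ t, fun x => ?_⟩
  obtain ⟨p, hp⟩ := hex (u x) (by rw [hu']; exact x.2)
  have h1 : h'.hom (u x) = g (w p) := by rw [hh, hp]
  have h2 : w p - t x = x := by
    apply Subtype.ext
    change v (d p) - (v (u x) - x) = x
    rw [hp]; abel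
  calc (h'.hom ∘ₗ u - g ∘ₗ t) x = h'.hom (u x) - g (t x) := rfl
    _ = g x := by rw [h1, ← map_sub, h2]

end Homological

section Alg

variable {R : Type} [Ring R] {J : Type} [Fintype J] [LinearOrder J] {e : J → R}

theorem mem_Pmod (h : IsCompletePrimitiveIdem R J e) (i : J) (x : R) :
    x ∈ Pmod R J e i ↔ x * e i = x := by
  constructor
  · rintro ⟨b, rfl⟩
    change b * e i * e i = b * e i
    rw [mul_assoc, (h.idem i).eq]
  · intro hx
    exact ⟨x, hx⟩

/-- The generator of `P i`. -/
def gen (h : IsCompletePrimitiveIdem R J e) (i : J) : Pmod R J e i :=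
  ⟨e i, (mem_Pmod h i _).2 (h.idem i)⟩

theorem smul_gen (h : IsCompletePrimitiveIdem R J e) (i : J) (x : Pmod R J e i) :
    (x : R) • gen h i = x := Subtype.ext ((mem_Pmod h i x).1 x.2)

theorem Pmod_indec (h : IsCompletePrimitiveIdem R J e) (i : J) : IndecL R (Pmod R J e i) := by
  intro N₁ N₂ hc
  have hg : gen h i ∈ N₁ ⊔ N₂ := by rw [hc.sup_eq_top]; trivial
  obtain ⟨f, hf, g, hg, hfg⟩ := Submodule.mem_sup.1 hg
  have hfg' : (f : R) + g = e i := congrArg Subtype.val hfg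
  have key : ∀ (A C : Submodule R (Pmod R J e i)), IsCompl A C → ∀ a ∈ A, ∀ c ∈ C,
      a + c = gen h i → (a : R) * c = 0 ∧ (a : R) * a = a := by
    intro A C hAC a ha c hc hac
    have h1 : (a : R) • a + (a : R) • c = a := by
      rw [← smul_add, hac, smul_gen]
    have h2 : (a : R) • c ∈ A := by
      rw [← eq_sub_iff_add_eq'] at h1
      rw [h1]; exact A.sub_mem ha (A.smul_mem _ ha)
    have h3 : (a : R) • c = 0 :=
      (Submodule.disjoint_def.1 hAC.disjoint) _ h2 (C.smul_mem _ hc)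
    refine ⟨congrArg Subtype.val h3, ?_⟩
    rw [h3, add_zero] at h1
    exact congrArg Subtype.val h1
  obtain ⟨k1, k2⟩ := key N₁ N₂ hc f hf g hg hfg
  obtain ⟨k3, k4⟩ := key N₂ N₁ hc.symm g hg f hf (by rw [add_comm]; exact hfg)
  have full : ∀ (A C : Submodule R (Pmod R J e i)), IsCompl A C → gen h i ∈ C → A = ⊥ := by
    intro A C hAC hC
    have : C = ⊤ := by
      rw [Submodule.eq_top_iff']
      intro x
      rw [← smul_gen h i x]
      exact C.smul_mem _ hC
    subst this
    exact hAC.inf_eq_bot ▸ by simp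
  rcases h.primitive i f g k2 k4 k1 k3 hfg'.symm with h0 | h0
  · left
    apply full _ _ hc
    have : f = 0 := Subtype.ext h0
    rw [← hfg, this, zero_add]; exact hg
  · right
    apply full _ _ hc.symm
    have : g = 0 := Subtype.ext h0
    rw [← hfg, this, add_zero]; exact hf

theorem Pmod_projective (h : IsCompletePrimitiveIdem R J e) (i : J) :
    Module.Projective R (Pmod R J e i) := by
  refine Module.Projective.of_split (Pmod R J e i).subtype
    (LinearMap.toSpanSingleton R (Pmod R J e i) (gen h i)) ?_
  ext1 x
  exact smul_gen h i x

theorem Pmod_nontrivial (h : IsCompletePrimitiveIdem R J e) (i : J) :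
    Nontrivial (Pmod R J e i) :=
  ⟨gen h i, 0, fun h0 => h.ne_zero i (congrArg Subtype.val h0)⟩

/-- The map `P l → M`, `b ↦ b • m`. -/
def pmap (e : J → R) {M : Type*} [AddCommGroup M] [Module R M] (l : J) (m : M) :
    Pmod R J e l →ₗ[R] M := LinearMap.toSpanSingleton R M m ∘ₗ (Pmod R J e l).subtype

theorem sum_smul (h : IsCompletePrimitiveIdem R J e) {M : Type*} [AddCommGroup M] [Module R M]
    (m : M) : ∑ l, e l • m = m := by
  rw [← Finset.sum_smul, h.sum_eq_one, one_smul]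

theorem e_smul_smul (h : IsCompletePrimitiveIdem R J e) {M : Type} [AddCommGroup M] [Module R M]
    (l : J) (m : M) : e l • e l • m = e l • m := by
  rw [smul_smul, (h.idem l).eq]

variable [IsArtinianRing R] [IsNoetherianRing R]

theorem rad_coatom (h : IsCompletePrimitiveIdem R J e) (i : J) :
    IsCoatom (radOf R (Pmod R J e i)) :=
  have := Pmod_projective h i
  have := Pmod_nontrivial h i
  radOf_coatom (Pmod_indec h i)

theorem le_rad (h : IsCompletePrimitiveIdem R J e) (i : J) {K : Submodule R (Pmod R J e i)}
    (hK : K ≠ ⊤) : K ≤ radOf R (Pmod R J e i) :=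
  have := Pmod_projective h i
  have := Pmod_nontrivial h i
  le_radOf (Pmod_indec h i) hK

theorem Smod_simple (h : IsCompletePrimitiveIdem R J e) (i : J) :
    IsSimpleModule R (Smod R J e i) := isSimpleModule_iff_isCoatom.2 (rad_coatom h i)

theorem hom_simple (h : IsCompletePrimitiveIdem R J e) {S : Type*} [AddCommGroup S] [Module R S]
    [IsSimpleModule R S] (l : J) (φ : Pmod R J e l →ₗ[R] S) (hφ : φ ≠ 0) :
    LinearMap.ker φ = radOf R (Pmod R J e l) ∧ Nonempty (Smod R J e l ≃ₗ[R] S) := by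
  have hs : Function.Surjective φ := LinearMap.surjective_of_ne_zero hφ
  have hne : LinearMap.ker φ ≠ ⊤ := fun h0 => hφ (LinearMap.ker_eq_top.1 h0)
  have hc : IsCoatom (LinearMap.ker φ) := by
    rw [← isSimpleModule_iff_isCoatom]
    exact IsSimpleModule.congr (φ.quotKerEquivOfSurjective hs)
  have hk : LinearMap.ker φ = radOf R (Pmod R J e l) :=
    ((hc.le_iff.1 (le_rad h l hne)).resolve_left (rad_coatom h l).1).symm
  exact ⟨hk, ⟨(Submodule.quotEquivOfEq _ _ hk.symm).trans (φ.quotKerEquivOfSurjective hs)⟩⟩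

theorem pmap_ne_zero (h : IsCompletePrimitiveIdem R J e) {M : Type*} [AddCommGroup M] [Module R M]
    (l : J) (m : M) (hm : e l • m ≠ 0) : pmap e l m ≠ 0 := fun h0 =>
  hm (LinearMap.congr_fun h0 (gen h l))

theorem simple_iso (h : IsCompletePrimitiveIdem R J e) (S : Type*) [AddCommGroup S] [Module R S]
    [IsSimpleModule R S] : ∃ i, Nonempty (S ≃ₗ[R] Smod R J e i) := by
  have := IsSimpleModule.nontrivial R S
  obtain ⟨s, hs⟩ := exists_ne (0 : S)
  rw [← sum_smul h s] at hs
  obtain ⟨l, -, hl⟩ := Finset.exists_ne_zero_of_sum_ne_zero hs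
  obtain ⟨-, ⟨E⟩⟩ := hom_simple h l _ (pmap_ne_zero h l s hl)
  exact ⟨l, ⟨E.symm⟩⟩

/-- A map from `P l` inducing a nonzero map to a simple top is surjective. -/
theorem surj_of_range (h : IsCompletePrimitiveIdem R J e) {M : Type*} [AddCommGroup M] [Module R M]
    (j : J) (f : M →ₗ[R] Pmod R J e j)
    (hf : ¬ LinearMap.range f ≤ radOf R (Pmod R J e j)) : Function.Surjective f := by
  rw [← LinearMap.range_eq_top]
  by_contra h0
  exact hf (le_rad h j h0)

/-- Surjection from indecomposable projective with top `S j` yields iso. -/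
theorem proj_iso (h : IsCompletePrimitiveIdem R J e) {M : Type*} [AddCommGroup M] [Module R M]
    [Module.Projective R M] (hM : IndecL R M) (j : J) (π : M →ₗ[R] Smod R J e j)
    (hπ : π ≠ 0) : Nonempty (M ≃ₗ[R] Pmod R J e j) := by
  obtain ⟨f, hf⟩ := Module.projective_lifting_property (radOf R (Pmod R J e j)).mkQ π
    (Submodule.mkQ_surjective _)
  have hs : Function.Surjective f := by
    apply surj_of_range h
    intro hle
    apply hπ
    rw [← hf]
    ext x
    rw [LinearMap.comp_apply, LinearMap.zero_apply, Submodule.mkQ_apply,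
      Submodule.Quotient.mk_eq_zero]
    exact hle ⟨x, rfl⟩
  have := Pmod_projective h j
  have := Pmod_nontrivial h j
  exact ⟨LinearEquiv.ofBijective f (surj_split hM f hs)⟩

theorem S_iso_eq (h : IsCompletePrimitiveIdem R J e)
    (hB : ∀ i j, i ≠ j → IsEmpty ((↥(Pmod R J e i)) ≃ₗ[R] ↥(Pmod R J e j)))
    {i j : J} (E : Smod R J e i ≃ₗ[R] Smod R J e j) : i = j := by
  by_contra hne
  have := Pmod_projective h i
  have := Smod_simple h i
  have := IsSimpleModule.nontrivial R (Smod R J e i)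
  obtain ⟨E'⟩ := proj_iso h (Pmod_indec h i) j (E.toLinearMap ∘ₗ (radOf R (Pmod R J e i)).mkQ) (by
    intro h0
    obtain ⟨s, hs⟩ := exists_ne (0 : Smod R J e i)
    obtain ⟨x, rfl⟩ := Submodule.mkQ_surjective _ s
    have := LinearMap.congr_fun h0 x
    apply hs
    exact E.injective (this.trans (map_zero E).symm))
  exact (hB i j hne).false E'

theorem e_smul_S (h : IsCompletePrimitiveIdem R J e)
    (hB : ∀ i j, i ≠ j → IsEmpty ((↥(Pmod R J e i)) ≃ₗ[R] ↥(Pmod R J e j)))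
    {l i : J} (hne : l ≠ i) (s : Smod R J e i) : e l • s = 0 := by
  by_contra hs
  have := Smod_simple h i
  obtain ⟨-, ⟨E⟩⟩ := hom_simple h l _ (pmap_ne_zero h l s hs)
  exact hne (S_iso_eq h hB E)

theorem trace_le (h : IsCompletePrimitiveIdem R J e)
    (hB : ∀ i j, i ≠ j → IsEmpty ((↥(Pmod R J e i)) ≃ₗ[R] ↥(Pmod R J e j))) (i : J) :
    traceSubL R J e i ≤ radOf R (Pmod R J e i) := by
  refine iSup_le fun j => iSup_le fun hj => iSup_le fun f => ?_
  by_contra hf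
  have hs := surj_of_range h i f hf
  have := Pmod_projective h i
  have := Pmod_nontrivial h i
  exact (hB j i (by rintro rfl; exact hj le_rfl)).false
    (LinearEquiv.ofBijective f (surj_split (Pmod_indec h j) f hs))

theorem le_trace (k : Type) [Field k] [Algebra k R] (h : IsCompletePrimitiveIdem R J e)
    (hE : ∀ i j, prec0 k R J e i j → i < j) (i : J) :
    radOf R (Pmod R J e i) ≤ traceSubL R J e i := by
  by_contra hle
  set rad := radOf R (Pmod R J e i) with hrad
  set T := traceSubL R J e i with hT
  have hT' : T.comap rad.subtype ≠ ⊤ := by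
    intro h0
    apply hle
    rwa [Submodule.comap_subtype_eq_top] at h0
  obtain ⟨N, hN, hTN⟩ := (eq_top_or_exists_le_coatom (T.comap rad.subtype)).resolve_left hT'
  have hsim : IsSimpleModule R (rad ⧸ N) := isSimpleModule_iff_isCoatom.2 hN
  obtain ⟨j, ⟨E⟩⟩ := simple_iso h (rad ⧸ N)
  let g : rad →ₗ[R] Smod R J e j := E.toLinearMap ∘ₗ N.mkQ
  have hgs : Function.Surjective g := E.surjective.comp N.mkQ_surjective
  have hgN : ∀ x ∈ N, g x = 0 := fun x hx => by
    change E (N.mkQ x) = 0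
    rw [Submodule.mkQ_apply, (Submodule.Quotient.mk_eq_zero N).2 hx, map_zero]
  have := Smod_simple h j
  have := IsSimpleModule.nontrivial R (Smod R J e j)
  have := Pmod_projective h i
  have := Pmod_projective h j
  have hij : i < j := by
    apply hE
    by_contra hext
    have hker : LinearMap.ker rad.mkQ = rad := Submodule.ker_mkQ _
    obtain ⟨g', hg'⟩ := ext_one_extend k R hext rad.mkQ rad.mkQ_surjective
      (g ∘ₗ (LinearEquiv.ofEq _ _ hker).toLinearMap)
    have hg'' : ∀ x : rad, g' x = g x := fun x => hg' ⟨x, by rw [hker]; exact x.2⟩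
    obtain ⟨s, hs⟩ := exists_ne (0 : Smod R J e j)
    obtain ⟨x, rfl⟩ := hgs s
    have hne : g' ≠ 0 := by
      rintro rfl
      exact hs (hg'' x).symm
    have hk := (hom_simple h i g' hne).1
    apply hs
    rw [← hg'']
    change (x : Pmod R J e i) ∈ LinearMap.ker g'
    rw [hk]
    exact x.2
  obtain ⟨f, hf⟩ := Module.projective_lifting_property g (radOf R (Pmod R J e j)).mkQ hgs
  obtain ⟨s, hs⟩ := exists_ne (0 : Smod R J e j)
  obtain ⟨x, rfl⟩ := Submodule.mkQ_surjective _ s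
  apply hs
  rw [← hf]
  apply hgN
  apply hTN
  change rad.subtype (f x) ∈ T
  have : LinearMap.range (rad.subtype ∘ₗ f) ≤ T :=
    le_iSup_of_le j (le_iSup_of_le (not_le.2 hij) (le_iSup_of_le (rad.subtype ∘ₗ f) le_rfl))
  exact this ⟨x, rfl⟩

/-- Support strictly above `i`. -/
def SuppGt (e : J → R) (i : J) (M : Type) [AddCommGroup M] [Module R M] : Prop :=
  ∀ l, l ≤ i → ∀ m : M, e l • m = 0

theorem supp_rad_of (i : J) (hT : traceSubL R J e i = radOf R (Pmod R J e i))
    (hP : ∀ j, i < j → ∀ l, l < j → ∀ x : Pmod R J e j, e l • x = 0) :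
    ∀ l, l ≤ i → ∀ x ∈ radOf R (Pmod R J e i), e l • x = 0 := by
  intro l hl x hx
  rw [← hT] at hx
  refine Submodule.iSup_induction _ (motive := fun x => e l • x = 0) hx ?_ (smul_zero _) ?_
  · intro j x hx
    refine Submodule.iSup_induction _ (motive := fun x => e l • x = 0) hx ?_ (smul_zero _) ?_
    · intro hj x hx
      refine Submodule.iSup_induction _ (motive := fun x => e l • x = 0) hx ?_ (smul_zero _) ?_
      · rintro f _ ⟨y, rfl⟩
        rw [← map_smul, hP j (not_le.1 hj) l (lt_of_le_of_lt hl (not_le.1 hj)), map_zero]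
      · intro x y hx hy; rw [smul_add, hx, hy, add_zero]
    · intro x y hx hy; rw [smul_add, hx, hy, add_zero]
  · intro x y hx hy; rw [smul_add, hx, hy, add_zero]

theorem supp_P (h : IsCompletePrimitiveIdem R J e)
    (hB : ∀ i j, i ≠ j → IsEmpty ((↥(Pmod R J e i)) ≃ₗ[R] ↥(Pmod R J e j)))
    (hT : ∀ i, traceSubL R J e i = radOf R (Pmod R J e i)) :
    ∀ j l, l < j → ∀ x : Pmod R J e j, e l • x = 0 := by
  intro j
  induction j using WellFoundedGT.induction with
  | ind j ih =>
    intro l hl x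
    rw [← e_smul_smul h]
    apply supp_rad_of j (hT j) (fun j' hj' => ih j' hj') l hl.le
    rw [← Submodule.Quotient.mk_eq_zero, Submodule.Quotient.mk_smul]
    exact e_smul_S h hB hl.ne _

theorem supp_cover (h : IsCompletePrimitiveIdem R J e) (i : J)
    (hP : ∀ j l, l < j → ∀ x : Pmod R J e j, e l • x = 0) (M : ModuleCat R) :
    ∃ p : ProjectivePresentation M, SuppGt e i M → SuppGt e i p.p := by
  classical
  by_cases hM : SuppGt e i M
  · let A : M × {l : J // i < l} → Type := fun a => Pmod R J e a.2.1
    let φ : (DirectSum _ A) →ₗ[R] M :=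
      DirectSum.toModule R _ M (fun a => pmap e a.2.1 a.1)
    have hφ : Function.Surjective φ := by
      rw [← LinearMap.range_eq_top, Submodule.eq_top_iff']
      intro m
      rw [← sum_smul h m]
      refine Submodule.sum_mem _ fun l _ => ?_
      by_cases hl : l ≤ i
      · rw [hM l hl]; exact Submodule.zero_mem _
      · refine ⟨DirectSum.lof R _ A (m, ⟨l, not_le.1 hl⟩) (gen h l), ?_⟩
        exact DirectSum.toModule_lof ..
    have : ∀ a, Module.Projective R (A a) := fun a => Pmod_projective h _
    have hpr : Module.Projective R (DirectSum _ A) :=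
      inferInstanceAs (Module.Projective R (Π₀ a, A a))
    refine ⟨{ p := ModuleCat.of R (DirectSum _ A)
              projective := (IsProjective.iff_projective (R := R) _).1 hpr
              f := ModuleCat.ofHom φ
              epi := (ModuleCat.epi_iff_surjective _).2 hφ }, fun _ => ?_⟩
    intro l hl x
    refine DFinsupp.ext (fun a => ?_)
    exact hP a.2.1 l (lt_of_le_of_lt hl a.2.2) _
  · obtain ⟨p⟩ := EnoughProjectives.presentation M
    exact ⟨p, fun h0 => absurd h0 hM⟩

theorem ext_lt (k : Type) [Field k] [Algebra k R] (h : IsCompletePrimitiveIdem R J e)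
    (hB : ∀ i j, i ≠ j → IsEmpty ((↥(Pmod R J e i)) ≃ₗ[R] ↥(Pmod R J e j)))
    (hT : ∀ i, traceSubL R J e i = radOf R (Pmod R J e i)) (n : ℕ) (i j : J)
    (hext : extNZ k R (n + 1) (SmodCat R J e i) (SmodCat R J e j)) : i < j := by
  by_contra hij
  have hP := supp_P h hB hT
  let π : ModuleCat.of R (Pmod R J e i) ⟶ SmodCat R J e i :=
    ModuleCat.ofHom (radOf R (Pmod R J e i)).mkQ
  have : Projective (ModuleCat.of R (Pmod R J e i)) :=
    (IsProjective.iff_projective (R := R) _).1 (Pmod_projective h i)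
  have : Epi π := (ModuleCat.epi_iff_surjective _).2 (Submodule.mkQ_surjective _)
  obtain ⟨Res, hRes⟩ := exists_resolution (fun M : ModuleCat R => SuppGt e i M)
    (by
      intro X Y f hf hY l hl x
      apply (ModuleCat.mono_iff_injective f).1 hf
      have := hY l hl (f.hom x)
      rw [← map_smul] at this
      exact this.trans (map_zero f.hom).symm)
    (supp_cover h i hP) _ _ π (by
      intro l hl x
      apply (ModuleCat.mono_iff_injective (Limits.kernel.ι π)).1 inferInstance
      have h1 : (Limits.kernel.ι π).hom x ∈ radOf R (Pmod R J e i) := by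
        rw [← Submodule.ker_mkQ (radOf R (Pmod R J e i)), LinearMap.mem_ker]
        exact LinearMap.congr_fun (congrArg ModuleCat.Hom.hom (Limits.kernel.condition π)) x
      have := supp_rad_of i (hT i) (fun j _ => hP j) l hl _ h1
      exact ((map_smul (Limits.kernel.ι π).hom (e l) x).trans this).trans
        (map_zero (Limits.kernel.ι π).hom).symm)
  refine ext_vanish k R Res (n + 1) (fun f => ?_) hext
  ext x
  change f.hom x = 0
  rw [← sum_smul h (f.hom x)]
  refine Finset.sum_eq_zero fun l _ => ?_
  by_cases hl : l = j
  · subst hl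
    rw [← map_smul, hRes n l (not_lt.1 hij), map_zero]
  · exact e_smul_S h hB hl _

end Alg

theorem schur_end (k : Type) [Field k] [IsAlgClosed k] (A : Type) [Ring A] [Algebra k A]
    [FiniteDimensional k A] (S : Type) [AddCommGroup S] [Module A S] [IsSimpleModule A S] :
    Nonempty (Module.End A S ≃+* k) := by
  let : Module k S := Module.compHom S (algebraMap k A)
  have : IsScalarTower k A S := ⟨fun x y z => by
    change (x • y) • z = algebraMap k A x • y • z
    rw [smul_smul, Algebra.smul_def]⟩
  have : Module.Finite A S := inferInstance
  have : FiniteDimensional k S := Module.Finite.trans A S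
  exact ⟨(RingEquiv.ofBijective (algebraMap k (Module.End A S))
      (IsSimpleModule.algebraMap_end_bijective_of_isAlgClosed k)).symm⟩

theorem IndecL_congr {R : Type} [Ring R] {M N : Type*} [AddCommGroup M] [Module R M]
    [AddCommGroup N] [Module R N] (E : M ≃ₗ[R] N) (h : IndecL R M) : IndecL R N := by
  intro N₁ N₂ hc
  have hc' : IsCompl ((Submodule.orderIsoMapComap E).symm N₁)
      ((Submodule.orderIsoMapComap E).symm N₂) :=
    OrderIso.isCompl (Submodule.orderIsoMapComap E).symm hc
  rcases h _ _ hc' with h1 | h1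
  · left; exact (map_eq_bot_iff (Submodule.orderIsoMapComap E).symm).1 h1
  · right; exact (map_eq_bot_iff (Submodule.orderIsoMapComap E).symm).1 h1

theorem proj_ulift.{v} {R : Type} [Ring R] {M : Type} [AddCommGroup M] [Module R M]
    (h : Module.Projective R M) : Projective (ModuleCat.of R (ULift.{v} M)) := by
  refine (IsProjective.iff_projective (R := R) (ULift.{v} M)).1 ?_
  exact Module.Projective.of_equiv (M := M) ULift.moduleEquiv.symm

/-- Let `B` be a directed basic finite-dimensional `k`-algebra with
(strict) precedence relation `≺` on the index set `ι`, and let `≤` be a linear order on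
`ι` with `i < j` whenever `i ≺ j`.  Then for each `i` the trace `T^L i` of the
projectives `P j` with `¬ (j ≤ i)` in `P i` equals `rad (P i)`, so the standard modules
relative to `(ι, ≤)` are the simple modules `S i`; moreover `(ι, ≤, {S i})` is a strict
homological system for `B` and `End_B (S i) ≅ k` for all `i`.  Consequently `B` is
quasi-hereditary with simple standard modules. -/
theorem statement6 (hIdem : IsCompletePrimitiveIdem B ι e)
    (hBasic : ∀ i j, i ≠ j → IsEmpty ((↥(Pmod B ι e i)) ≃ₗ[B] ↥(Pmod B ι e j)))
    (hDirected : ∀ i, ¬ prec k B ι e i i)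
    (hLin : ∀ i j, prec k B ι e i j → i < j) :
    (∀ i : ι,
      traceSubL B ι e i = radOf B ↥(Pmod B ι e i) ∧
      Nonempty ((↥(Pmod B ι e i) ⧸ traceSubL B ι e i) ≃ₗ[B] Smod B ι e i) ∧
      Nonempty ((Module.End B (Smod B ι e i)) ≃+* k)) ∧
    (∀ i, Module.Finite B (Smod B ι e i) ∧ Indec B (SmodCat B ι e i)) ∧
    (∀ i j, i ≠ j → IsEmpty ((Smod B ι e i) ≃ₗ[B] (Smod B ι e j))) ∧
    (∀ i j, (∃ f : (Smod B ι e i) →ₗ[B] (Smod B ι e j), f ≠ 0) → i ≤ j) ∧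
    (HasFiltBy B ι (SmodCat B ι e) (fun _ => True) B) ∧
    (∃ P : ι → ModuleCat B, IsCompleteProjFam B ι P) ∧
    (∀ (n : ℕ), 1 ≤ n → ∀ i j,
      extNZ k B n (SmodCat B ι e i) (SmodCat B ι e j) → i < j) := by
  have hA : IsArtinianRing B := IsArtinianRing.of_finite k B
  have hN : IsNoetherianRing B := IsNoetherianRing.of_finite k B
  have hT : ∀ i, traceSubL B ι e i = radOf B (Pmod B ι e i) := fun i =>
    le_antisymm (trace_le hIdem hBasic i)
      (le_trace k hIdem (fun i j hij => hLin i j (Relation.TransGen.single hij)) i)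
  have hS : ∀ i, IsSimpleModule B (Smod B ι e i) := Smod_simple hIdem
  refine ⟨fun i => ⟨hT i, ⟨Submodule.quotEquivOfEq _ _ (hT i)⟩, ?_⟩, fun i => ⟨?_, ?_⟩, ?_, ?_,
    ?_, ?_, ?_⟩
  · exact schur_end k B (Smod B ι e i)
  · infer_instance
  · refine ⟨IsSimpleModule.nontrivial B (Smod B ι e i), fun N₁ N₂ hc => ?_⟩
    rcases eq_bot_or_eq_top (α := Submodule B (Smod B ι e i)) N₁ with h | h
    · exact Or.inl h
    · right
      rw [h] at hc
      exact eq_bot_of_isCompl_top hc.symm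
  · exact fun i j hij => ⟨fun E => hij (S_iso_eq hIdem hBasic E)⟩
  · rintro i j ⟨f, hf⟩
    exact (S_iso_eq hIdem hBasic
      (LinearEquiv.ofBijective f (LinearMap.bijective_of_ne_zero hf))).le
  · right
    obtain ⟨s, h0, h1⟩ := exists_compositionSeries_of_isNoetherian_isArtinian B B
    refine ⟨s.length, s.toFun, s.strictMono.monotone, h0, h1, fun r => ?_⟩
    have hcov : s.toFun r.castSucc ⋖ s.toFun r.succ := s.step r
    have hs := (covBy_iff_quot_is_simple hcov.le).1 hcov
    obtain ⟨i, ⟨E⟩⟩ := simple_iso hIdem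
      (↥(s.toFun r.succ) ⧸ Submodule.comap (s.toFun r.succ).subtype (s.toFun r.castSucc))
    exact ⟨i, trivial, ⟨E⟩⟩
  · have hpr := Pmod_projective hIdem
    refine ⟨fun i => ModuleCat.of B (ULift (Pmod B ι e i)), fun i => ⟨?_, ⟨?_, ?_⟩, ?_⟩,
      fun i j hij => ⟨fun E => (hBasic i j hij).false
        ((ULift.moduleEquiv.symm.trans E.toLinearEquiv).trans ULift.moduleEquiv)⟩, ?_⟩
    · change Module.Finite B (ULift (Pmod B ι e i))
      infer_instance
    · have := Pmod_nontrivial hIdem i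
      change Nontrivial (ULift (Pmod B ι e i))
      infer_instance
    · exact IndecL_congr ULift.moduleEquiv.symm (Pmod_indec hIdem i)
    · exact proj_ulift (hpr i)
    · intro X hfin hind hproj
      have hX : Module.Projective B X := (IsProjective.iff_projective (R := B) X).2 hproj
      have := hind.1
      obtain ⟨K, hK, -⟩ :=
        (eq_top_or_exists_le_coatom (⊥ : Submodule B X)).resolve_left bot_ne_top
      have := isSimpleModule_iff_isCoatom.2 hK
      obtain ⟨i, ⟨E⟩⟩ := simple_iso hIdem (X ⧸ K)
      obtain ⟨E'⟩ := proj_iso hIdem hind.2 i (E.toLinearMap ∘ₗ K.mkQ) (by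
        intro h0
        apply hK.1
        rw [Submodule.eq_top_iff']
        intro x
        rw [← Submodule.Quotient.mk_eq_zero]
        exact E.injective ((LinearMap.congr_fun h0 x).trans (map_zero E).symm))
      exact ⟨i, ⟨(E'.trans ULift.moduleEquiv.symm).toModuleIso⟩⟩
  · intro n hn i j hext
    obtain ⟨m, rfl⟩ : ∃ m, n = m + 1 := ⟨n - 1, by omega⟩
    exact ext_lt k hIdem hBasic hT m i j hext

end
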